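/- The number of connected components (for the Euclidean topology) of the complement H₁(Γ,ℝ) ∖ ⋃_{H ∈ C_Γ^⊥} H of the cographic arrangement equals the number of totally cyclic orientations of Γ∖E_sep. -/

import Mathlib

/-!
Serre-style finite graphs: a vertex type `V`, an oriented-edge type `E` with a
fixed-point-free involution `inv` (edge reversal) and source/target maps `s, t`
with `s (inv e) = t e`.  An unoriented edge is an `inv`-orbit `{e, inv e}`;
subsets of unoriented edges are encoded as `inv`-closed subsets of `E`, and an
orientation of a spanning subgraph `Γ∖T` is encoded by the set `O` of its
positively oriented edges.  1-chains with coefficients in `A` are encoded as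
functions `c : E → A` with `c (inv e) = - c e` (so that `(c, e⃗) = c e` for the
standard bilinear form).
-/

structure SerreGraph where
  V : Type
  E : Type
  [fintypeV : Fintype V]
  [fintypeE : Fintype E]
  [decEqV : DecidableEq V]
  [decEqE : DecidableEq E]
  inv : E → E
  s : E → V
  t : E → V
  inv_inv : ∀ e, inv (inv e) = e
  inv_ne : ∀ e, inv e ≠ e
  s_inv : ∀ e, s (inv e) = t e

attribute [instance] SerreGraph.fintypeV SerreGraph.fintypeE
attribute [instance] SerreGraph.decEqV SerreGraph.decEqE

namespace SerreGraph

variable (Γ : SerreGraph)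

/-- Reachability between vertices in the spanning subgraph whose allowed oriented
edges are those in `A`. -/
def Reach (A : Set Γ.E) : Γ.V → Γ.V → Prop :=
  Relation.ReflTransGen (fun a b => ∃ e ∈ A, Γ.s e = a ∧ Γ.t e = b)

/-- The number of connected components of the spanning subgraph with allowed
oriented edges `A`. -/
noncomputable def numComponents (A : Set Γ.E) : ℕ :=
  Nat.card (Quot (fun a b : Γ.V => ∃ e ∈ A, Γ.s e = a ∧ Γ.t e = b))

/-- The set of separating (oriented) edges: removing the underlying unoriented
edge increases the number of connected components. -/
def Esep : Set Γ.E :=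
  {e | Γ.numComponents Set.univ < Γ.numComponents {f | f ≠ e ∧ f ≠ Γ.inv e}}

/-- `T` encodes a set of unoriented edges. -/
def InvClosed (T : Set Γ.E) : Prop := ∀ e, e ∈ T ↔ Γ.inv e ∈ T

/-- `O` is (the set of positively oriented edges of) an orientation of `Γ∖T`. -/
def IsOrientation (T O : Set Γ.E) : Prop :=
  (∀ e ∈ O, e ∉ T) ∧ ∀ e, e ∉ T → (e ∈ O ↔ Γ.inv e ∉ O)

/-- A totally cyclic orientation of `Γ∖T`: an orientation such that there is no
vertex set `W` which is nonempty and proper inside some connected component of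
`Γ∖T` and such that all edges of `Γ∖T` crossing the boundary of `W` are oriented
out of `W` (this is the componentwise condition of the paper). -/
def IsTotallyCyclic (T O : Set Γ.E) : Prop :=
  Γ.IsOrientation T O ∧
    ¬ ∃ W : Set Γ.V, (∃ v ∈ W, ∃ w ∈ Wᶜ, Γ.Reach Tᶜ v w) ∧
        ∀ e ∈ O, Γ.t e ∈ W → Γ.s e ∈ W

/-- `γ` is (the set of positively oriented edges of) an oriented circuit of `Γ`:
a cyclic subgraph (connected, first Betti number one, no separating edges)
together with a totally cyclic orientation; equivalently a directed cycle:
each incident vertex has exactly one outgoing and one incoming edge in `γ`,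
and the support is connected. -/
def IsCircuit (γ : Finset Γ.E) : Prop :=
  γ.Nonempty ∧ (∀ e ∈ γ, Γ.inv e ∉ γ) ∧
    (∀ v ∈ γ.image Γ.s ∪ γ.image Γ.t, ∃! e, e ∈ γ ∧ Γ.s e = v) ∧
    (∀ v ∈ γ.image Γ.s ∪ γ.image Γ.t, ∃! e, e ∈ γ ∧ Γ.t e = v) ∧
    ∀ e ∈ γ, ∀ f ∈ γ, Γ.Reach ((↑γ : Set Γ.E) ∪ Γ.inv '' ↑γ) (Γ.s e) (Γ.s f)

/-- The class `[γ] ∈ H₁(Γ,ℤ)` of an oriented circuit. -/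
def circChainZ (γ : Finset Γ.E) : Γ.E → ℤ :=
  fun e => if e ∈ γ then 1 else if Γ.inv e ∈ γ then -1 else 0

/-- The class `[γ] ∈ H₁(Γ,ℝ)` of an oriented circuit. -/
noncomputable def circChainR (γ : Finset Γ.E) : Γ.E → ℝ :=
  fun e => (Γ.circChainZ γ e : ℝ)

/-- `Cir_φ(Γ∖T)`: oriented circuits of `Γ∖T` compatibly oriented with the
orientation with positive edges `O`. -/
def Cir (T O : Set Γ.E) : Set (Finset Γ.E) :=
  {γ | Γ.IsCircuit γ ∧ (∀ e ∈ γ, e ∈ O) ∧ ∀ e ∈ γ, e ∉ T}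

/-- `c` is a 1-cycle: a skew 1-chain with vanishing boundary, i.e. an element of
`H₁(Γ,A)`. -/
def IsCycle {A : Type*} [AddCommGroup A] (c : Γ.E → A) : Prop :=
  (∀ e, c (Γ.inv e) = - c e) ∧
    ∀ v, ∑ e ∈ Finset.univ.filter (fun e => Γ.t e = v), c e = 0

/-- An element of `H₁(Γ∖T, A) ⊆ H₁(Γ,A)`: a cycle supported on edges not in `T`. -/
def IsCycleOn {A : Type*} [AddCommGroup A] (T : Set Γ.E) (c : Γ.E → A) : Prop :=
  Γ.IsCycle c ∧ ∀ e ∈ T, c e = 0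

/-- The standard positive definite bilinear form on `C⃗₁(Γ,ℝ)`, for which
`(c, e⃗) = c e`. -/
noncomputable def pair (c c' : Γ.E → ℝ) : ℝ := (∑ e, c e * c' e) / 2

/-- The first Betti number `b₁(Γ) = dim_ℝ H₁(Γ,ℝ)`. -/
noncomputable def b1 : ℕ :=
  Module.finrank ℝ (Submodule.span ℝ {c : Γ.E → ℝ | Γ.IsCycle c})

/-- `b₁(Γ∖T) = dim_ℝ H₁(Γ∖T,ℝ)`. -/
noncomputable def b1Sub (T : Set Γ.E) : ℕ :=
  Module.finrank ℝ (Submodule.span ℝ {c : Γ.E → ℝ | Γ.IsCycleOn T c})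

/-- The cone `σ(T,φ) ⊆ H₁(Γ,ℝ)` of the cographic fan associated to a pair
`(T, O)` with `O` an orientation of `Γ∖T`. -/
def sigmaCone (T O : Set Γ.E) : Set (Γ.E → ℝ) :=
  {v | Γ.IsCycle v ∧ (∀ e ∈ O, 0 ≤ v e) ∧ ∀ e ∈ T, v e = 0}

/-- The poset `OP_Γ` of totally cyclic orientations: pairs `(T, O)` with `T` a
set of unoriented edges and `O` a totally cyclic orientation of `Γ∖T`. -/
def OP : Set (Set Γ.E × Set Γ.E) :=
  {p | Γ.InvClosed p.1 ∧ Γ.IsTotallyCyclic p.1 p.2}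

/-- The order on `OP_Γ`: `(T',φ') ≤ (T,φ)` iff `T' ⊇ T` and `φ'` is the
restriction of `φ`. -/
def OPle (p q : Set Γ.E × Set Γ.E) : Prop :=
  q.1 ⊆ p.1 ∧ p.2 = q.2 ∩ p.1ᶜ

/-- `H₁(Γ,ℤ)` viewed as the set of lattice points of `H₁(Γ,ℝ)`. -/
def H1Z : Set (Γ.E → ℝ) := {c | Γ.IsCycle c ∧ ∀ e, ∃ n : ℤ, c e = (n : ℝ)}

/-- The Voronoi polytope `Vor_Γ ⊆ H₁(Γ,ℝ)`. -/
def voronoi : Set (Γ.E → ℝ) :=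
  {v | Γ.IsCycle v ∧ ∀ l ∈ Γ.H1Z, Γ.pair v v ≤ Γ.pair (v - l) (v - l)}

/-- A (exposed) face of the Voronoi polytope. -/
def IsVorFace (F : Set (Γ.E → ℝ)) : Prop :=
  ∃ l : (Γ.E → ℝ) →ₗ[ℝ] ℝ, F = {v | v ∈ Γ.voronoi ∧ ∀ w ∈ Γ.voronoi, l w ≤ l v}

/-- The face `F(T,φ)` of the Voronoi polytope associated to `(T,O) ∈ OP_Γ`. -/
def vorFace (T O : Set Γ.E) : Set (Γ.E → ℝ) :=
  {v | v ∈ Γ.voronoi ∧ ∀ γ ∈ Γ.Cir T O,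
      Γ.pair v (Γ.circChainR γ) = Γ.pair (Γ.circChainR γ) (Γ.circChainR γ) / 2}

end SerreGraph

namespace SerreGraph

variable {Γ : SerreGraph}

theorem t_inv (e : Γ.E) : Γ.t (Γ.inv e) = Γ.s e := by
  rw [← Γ.s_inv, Γ.inv_inv]

theorem Reach.exists_edge_leaving {A : Set Γ.E} {W : Set Γ.V} {v w : Γ.V}
    (h : Γ.Reach A v w) (hv : v ∈ W) (hw : w ∉ W) :
    ∃ e ∈ A, Γ.s e ∈ W ∧ Γ.t e ∉ W := by
  by_contra! H
  refine hw ?_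
  clear hw
  induction h with
  | refl => exact hv
  | tail _ h ih =>
    obtain ⟨e, he, rfl, rfl⟩ := h
    exact H e he ih

theorem inv_mem_Esep {e : Γ.E} : Γ.inv e ∈ Γ.Esep ↔ e ∈ Γ.Esep := by
  simp only [Esep, Set.mem_ofPred_eq, Γ.inv_inv, and_comm]

/-- The endpoints of a separating edge are not connected in the complement of that edge. -/
theorem not_reach_of_mem_Esep {e : Γ.E} (he : e ∈ Γ.Esep) :
    ¬ Γ.Reach {f | f ≠ e ∧ f ≠ Γ.inv e} (Γ.s e) (Γ.t e) := by
  intro h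
  refine (not_lt.2 ?_) (show Γ.numComponents _ < Γ.numComponents _ from he)
  have hst : Quot.mk (fun a b : Γ.V =>
      ∃ f ∈ {f | f ≠ e ∧ f ≠ Γ.inv e}, Γ.s f = a ∧ Γ.t f = b) (Γ.s e) = Quot.mk _ (Γ.t e) := by
    generalize Γ.t e = b at h
    induction h with
    | refl => rfl
    | tail _ h ih => exact ih.trans (Quot.sound h)
  refine Nat.card_le_card_of_surjective
    (Quot.lift (fun a => Quot.mk _ a) ?_) ?_
  · rintro _ _ ⟨f, -, rfl, rfl⟩
    by_cases h1 : f = e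
    · rw [h1]; exact hst
    by_cases h2 : f = Γ.inv e
    · rw [h2, t_inv, Γ.s_inv]; exact hst.symm
    exact Quot.sound ⟨f, ⟨h1, h2⟩, rfl, rfl⟩
  · rintro ⟨a⟩
    exact ⟨Quot.mk _ a, rfl⟩

open Classical in
/-- The total flow of a cycle into a vertex set vanishes. -/
theorem IsCycle.sum_entering_eq_zero {c : Γ.E → ℝ} (hc : Γ.IsCycle c) (W : Set Γ.V) :
    ∑ e with Γ.t e ∈ W ∧ Γ.s e ∉ W, c e = 0 := by
  have htotal : ∑ e with Γ.t e ∈ W, c e = 0 := by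
    rw [← Finset.sum_fiberwise_of_maps_to (t := Finset.univ.filter (· ∈ W)) (g := Γ.t)
      (by simp)]
    refine Finset.sum_eq_zero fun v hv => ?_
    rw [← hc.2 v, Finset.filter_filter]
    refine Finset.sum_congr (Finset.filter_congr fun e _ => ?_) fun _ _ => rfl
    have : v ∈ W := by simpa using hv
    constructor
    · exact And.right
    · rintro rfl; exact ⟨this, rfl⟩
  have hinner : ∑ e with Γ.t e ∈ W ∧ Γ.s e ∈ W, c e = 0 := by
    have h : ∑ e with Γ.t e ∈ W ∧ Γ.s e ∈ W, c e
        = ∑ e with Γ.t e ∈ W ∧ Γ.s e ∈ W, - c e := by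
      refine Finset.sum_bij' (fun e _ => Γ.inv e) (fun e _ => Γ.inv e) ?_ ?_ ?_ ?_ ?_
      · simp [t_inv, Γ.s_inv, and_comm]
      · simp [t_inv, Γ.s_inv, and_comm]
      · simp [Γ.inv_inv]
      · simp [Γ.inv_inv]
      · simp [hc.1]
    rw [Finset.sum_neg_distrib] at h
    linarith
  rw [← Finset.sum_filter_add_sum_filter_not _ (fun e => Γ.s e ∈ W), Finset.filter_filter,
    Finset.filter_filter, hinner, zero_add] at htotal
  exact htotal

/-- Cycles vanish on separating edges. -/
theorem IsCycle.apply_eq_zero {c : Γ.E → ℝ} (hc : Γ.IsCycle c) {e : Γ.E} (he : e ∈ Γ.Esep) :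
    c e = 0 := by
  classical
  set W : Set Γ.V := {v | Γ.Reach {f | f ≠ e ∧ f ≠ Γ.inv e} (Γ.s e) v}
  have hs : Γ.s e ∈ W := Relation.ReflTransGen.refl
  have ht : Γ.t e ∉ W := not_reach_of_mem_Esep he
  have hsum := hc.sum_entering_eq_zero W
  rw [Finset.sum_eq_single (Γ.inv e)] at hsum
  · simpa [hc.1] using hsum
  · intro f hf hne
    obtain ⟨hft, hfs⟩ : Γ.t f ∈ W ∧ Γ.s f ∉ W := by simpa using hf
    by_cases hfe : f = e
    · exact absurd (hfe ▸ hft) ht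
    refine absurd ?_ hfs
    refine Relation.ReflTransGen.tail hft ⟨Γ.inv f, ⟨?_, ?_⟩, Γ.s_inv f, t_inv f⟩
    · rintro rfl; exact hne (Γ.inv_inv f).symm
    · intro h; exact hfe (by rw [← Γ.inv_inv f, h, Γ.inv_inv])
  · intro h
    exact absurd (by simpa [t_inv, Γ.s_inv] using ⟨hs, ht⟩) h

variable (Γ) in
/-- The complement of the cographic arrangement in `H₁(Γ,ℝ)`. -/
def cographicComplement : Set (Γ.E → ℝ) :=
  {v | Γ.IsCycle v ∧ ∀ e, e ∉ Γ.Esep → v e ≠ 0}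

/-- The edges on which a chain is positive. -/
def posEdges (c : Γ.E → ℝ) : Set Γ.E := {e | 0 < c e}

theorem isTotallyCyclic_posEdges {c : Γ.E → ℝ} (hc : c ∈ Γ.cographicComplement) :
    Γ.IsTotallyCyclic Γ.Esep (posEdges c) := by
  classical
  obtain ⟨hc, hne⟩ := hc
  refine ⟨⟨fun e he hes => ?_, fun e he => ?_⟩, ?_⟩
  · exact (ne_of_gt he) (hc.apply_eq_zero hes)
  · simp only [posEdges, Set.mem_ofPred_eq, hc.1, not_lt, Left.neg_nonpos_iff]
    exact ⟨le_of_lt, fun h => lt_of_le_of_ne h (hne e he).symm⟩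
  · rintro ⟨W, ⟨v, hv, w, hw, hvw⟩, hW⟩
    obtain ⟨e, he, hs, ht⟩ := hvw.exists_edge_leaving hv hw
    have hnonpos : ∀ f ∈ Finset.univ.filter (fun f => Γ.t f ∈ W ∧ Γ.s f ∉ W), c f ≤ 0 := by
      intro f hf
      obtain ⟨hft, hfs⟩ : Γ.t f ∈ W ∧ Γ.s f ∉ W := by simpa using hf
      exact not_lt.1 fun h => hfs (hW f h hft)
    have hzero := (Finset.sum_eq_zero_iff_of_nonpos hnonpos).1 (hc.sum_entering_eq_zero W)
      (Γ.inv e) (by simpa [t_inv, Γ.s_inv] using ⟨hs, ht⟩)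
    exact hne _ (inv_mem_Esep.not.2 he) hzero

/-- The elementary chain of an oriented edge. -/
def edgeChain (e : Γ.E) : Γ.E → ℝ :=
  fun f => (if f = e then 1 else 0) - (if f = Γ.inv e then 1 else 0)

theorem edgeChain_inv (e f : Γ.E) : edgeChain e (Γ.inv f) = - edgeChain e f := by
  have h1 : Γ.inv f = e ↔ f = Γ.inv e :=
    ⟨fun h => by rw [← h, Γ.inv_inv], fun h => by rw [h, Γ.inv_inv]⟩
  have h2 : Γ.inv f = Γ.inv e ↔ f = e :=
    ⟨fun h => by rw [← Γ.inv_inv f, h, Γ.inv_inv], fun h => by rw [h]⟩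
  simp only [edgeChain, h1, h2]
  ring

theorem edgeChain_self (e : Γ.E) : edgeChain e e = 1 := by
  simp [edgeChain, (Γ.inv_ne e).symm]

theorem edgeChain_nonneg {e f : Γ.E} (h : f ≠ Γ.inv e) : 0 ≤ edgeChain e f := by
  simp only [edgeChain, h, if_false, sub_zero]
  split_ifs <;> norm_num

theorem sum_edgeChain (e : Γ.E) (v : Γ.V) :
    ∑ f with Γ.t f = v, edgeChain e f =
      (if Γ.t e = v then 1 else 0) - (if Γ.s e = v then 1 else 0) := by
  simp [edgeChain, Finset.sum_sub_distrib, Finset.sum_ite_eq', t_inv]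

/-- A directed path supports a chain that is nonnegative along the orientation, with boundary the
difference of its endpoints. -/
theorem Reach.exists_chain {O : Set Γ.E} (hO : ∀ e ∈ O, Γ.inv e ∉ O) {a b : Γ.V}
    (h : Γ.Reach O a b) :
    ∃ c : Γ.E → ℝ, (∀ e, c (Γ.inv e) = - c e) ∧ (∀ e ∈ O, 0 ≤ c e) ∧
      ∀ v, ∑ e with Γ.t e = v, c e = (if b = v then 1 else 0) - (if a = v then 1 else 0) := by
  induction h with
  | refl => exact ⟨0, by simp, by simp, by simp⟩
  | tail _ h ih =>
    obtain ⟨e, he, rfl, rfl⟩ := h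
    obtain ⟨c, hskew, hpos, hbd⟩ := ih
    refine ⟨c + edgeChain e, fun f => ?_, fun f hf => ?_, fun v => ?_⟩
    · simp only [Pi.add_apply, hskew, edgeChain_inv]
      ring
    · exact add_nonneg (hpos f hf) (edgeChain_nonneg (by rintro rfl; exact hO e he hf))
    · simp only [Pi.add_apply, Finset.sum_add_distrib, hbd, sum_edgeChain]
      ring

/-- Every edge of a totally cyclic orientation lies on a directed closed path. -/
theorem IsTotallyCyclic.reach {T O : Set Γ.E} (h : Γ.IsTotallyCyclic T O) {e : Γ.E}
    (he : e ∈ O) : Γ.Reach O (Γ.t e) (Γ.s e) := by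
  by_contra hr
  refine h.2 ⟨{v | ¬ Γ.Reach O (Γ.t e) v}, ⟨Γ.s e, hr, Γ.t e, ?_, ?_⟩, fun f hf ht hs => ?_⟩
  · exact not_not.2 Relation.ReflTransGen.refl
  · exact Relation.ReflTransGen.single ⟨e, h.1.1 e he, rfl, rfl⟩
  · exact ht (Relation.ReflTransGen.tail hs ⟨f, hf, rfl, rfl⟩)

theorem IsTotallyCyclic.exists_cycle_pos {T O : Set Γ.E} (h : Γ.IsTotallyCyclic T O) :
    ∃ c : Γ.E → ℝ, Γ.IsCycle c ∧ ∀ e ∈ O, 0 < c e := by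
  classical
  have hO : ∀ e ∈ O, Γ.inv e ∉ O := fun e he => (h.1.2 e (h.1.1 e he)).1 he
  have hcycle : ∀ e, ∃ c : Γ.E → ℝ,
      Γ.IsCycle c ∧ (∀ f ∈ O, 0 ≤ c f) ∧ (e ∈ O → 0 < c e) := by
    intro e
    by_cases he : e ∈ O
    · obtain ⟨c, hskew, hpos, hbd⟩ := (h.reach he).exists_chain hO
      refine ⟨c + edgeChain e, ⟨fun f => ?_, fun v => ?_⟩, fun f hf => ?_, fun _ => ?_⟩
      · simp only [Pi.add_apply, hskew, edgeChain_inv]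
        ring
      · simp only [Pi.add_apply, Finset.sum_add_distrib, hbd, sum_edgeChain]
        ring
      · exact add_nonneg (hpos f hf) (edgeChain_nonneg (by rintro rfl; exact hO e he hf))
      · exact add_pos_of_nonneg_of_pos (hpos e he) (by simp [edgeChain_self])
    · exact ⟨0, ⟨by simp, by simp⟩, by simp, fun h => absurd h he⟩
  choose c hc hnonneg hpos using hcycle
  refine ⟨fun f => ∑ e, c e f, ⟨fun f => ?_, fun v => ?_⟩, fun e he => ?_⟩
  · simp [(hc _).1]
  · rw [Finset.sum_comm]
    exact Finset.sum_eq_zero fun e _ => (hc e).2 v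
  · exact Finset.sum_pos' (fun f _ => hnonneg f e he) ⟨e, Finset.mem_univ _, hpos e he⟩

theorem IsTotallyCyclic.exists_posEdges_eq {O : Set Γ.E} (h : Γ.IsTotallyCyclic Γ.Esep O) :
    ∃ c ∈ Γ.cographicComplement, posEdges c = O := by
  obtain ⟨c, hc, hpos⟩ := h.exists_cycle_pos
  have hneg : ∀ e ∉ Γ.Esep, e ∉ O → c e < 0 := fun e he heO => by
    have := hpos (Γ.inv e) (not_not.1 ((h.1.2 e he).not.1 heO))
    rw [hc.1] at this
    linarith
  refine ⟨c, ⟨hc, fun e he => ?_⟩, Set.ext fun e => ⟨fun he => ?_, hpos e⟩⟩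
  · by_cases heO : e ∈ O
    · exact (hpos e heO).ne'
    · exact (hneg e he heO).ne
  · by_contra heO
    by_cases hes : e ∈ Γ.Esep
    · exact (ne_of_gt he) (hc.apply_eq_zero hes)
    · exact lt_asymm he (hneg e hes heO)

theorem isLocallyConstant_posEdges :
    IsLocallyConstant fun c : Γ.cographicComplement => posEdges (c : Γ.E → ℝ) := by
  rw [IsLocallyConstant.iff_eventually_eq]
  intro x
  have hcont : ∀ e, Continuous fun y : Γ.cographicComplement => (y : Γ.E → ℝ) e :=
    fun e => (continuous_apply e).comp continuous_subtype_val
  have : ∀ e, ∀ᶠ y : Γ.cographicComplement in nhds x, (0 < (y : Γ.E → ℝ) e ↔ 0 < (x : Γ.E → ℝ) e) := by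
    intro e
    by_cases he : e ∈ Γ.Esep
    · exact Filter.Eventually.of_forall fun y => by
        rw [y.2.1.apply_eq_zero he, x.2.1.apply_eq_zero he]
    · rcases lt_or_gt_of_ne (x.2.2 e he) with h | h
      · filter_upwards [(hcont e).continuousAt.eventually_lt continuousAt_const h] with y hy
        exact ⟨fun h' => absurd h' hy.not_gt, fun h' => absurd h' h.not_gt⟩
      · filter_upwards [continuousAt_const.eventually_lt (hcont e).continuousAt h] with y hy
        exact ⟨fun _ => h, fun _ => hy⟩
  filter_upwards [Filter.eventually_all.2 this] with y hy
  exact Set.ext hy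

theorem convex_cographicChamber (O : Set Γ.E) :
    Convex ℝ {c | c ∈ Γ.cographicComplement ∧ posEdges c = O} := by
  rintro x ⟨hx, rfl⟩ y ⟨hy, hxy⟩ a b ha hb hab
  have hsign : ∀ e, (0 < y e ↔ 0 < x e) := fun e => Set.ext_iff.1 hxy e
  have hcycle : Γ.IsCycle (a • x + b • y) := by
    refine ⟨fun e => ?_, fun v => ?_⟩
    · simp only [Pi.add_apply, Pi.smul_apply, smul_eq_mul, hx.1.1, hy.1.1]
      ring
    · simp only [Pi.add_apply, Pi.smul_apply, smul_eq_mul, Finset.sum_add_distrib,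
        ← Finset.mul_sum, hx.1.2, hy.1.2]
      simp
  have hpos : ∀ e, 0 < x e → 0 < (a • x + b • y) e := fun e he =>
    (convex_Ioi (0 : ℝ)) (Set.mem_Ioi.2 he) (Set.mem_Ioi.2 ((hsign e).2 he)) ha hb hab
  have hneg : ∀ e ∉ Γ.Esep, ¬ 0 < x e → (a • x + b • y) e < 0 := fun e hes he =>
    (convex_Iio (0 : ℝ))
      (Set.mem_Iio.2 (lt_of_le_of_ne (not_lt.1 he) (hx.2 e hes)))
      (Set.mem_Iio.2 (lt_of_le_of_ne (not_lt.1 ((hsign e).not.2 he)) (hy.2 e hes))) ha hb hab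
  refine ⟨⟨hcycle, fun e hes => ?_⟩, Set.ext fun e => ⟨fun h => ?_, hpos e⟩⟩
  · by_cases he : 0 < x e
    · exact (hpos e he).ne'
    · exact (hneg e hes he).ne
  · by_contra he
    by_cases hes : e ∈ Γ.Esep
    · exact (ne_of_gt h) (hcycle.apply_eq_zero hes)
    · exact lt_asymm h (hneg e hes he)

theorem connectedComponents_mk_eq_iff {x y : Γ.cographicComplement} :
    (x : ConnectedComponents Γ.cographicComplement) = y ↔
      posEdges (x : Γ.E → ℝ) = posEdges (y : Γ.E → ℝ) := by
  rw [ConnectedComponents.coe_eq_coe']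
  constructor
  · exact fun h => isLocallyConstant_posEdges.apply_eq_of_isPreconnected
      isPreconnected_connectedComponent h mem_connectedComponent
  · intro h
    have hpre : IsPreconnected
        {z : Γ.cographicComplement | posEdges (z : Γ.E → ℝ) = posEdges (y : Γ.E → ℝ)} := by
      rw [← Topology.IsInducing.subtypeVal.isPreconnected_image]
      convert (convex_cographicChamber (posEdges (y : Γ.E → ℝ))).isPreconnected using 1
      ext z
      simp [and_comm]
    exact hpre.subset_connectedComponent rfl h

end SerreGraph

/-- The number of connected components of the complement of the
cographic arrangement in `H₁(Γ,ℝ)` equals the number of totally cyclic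
orientations of `Γ∖E_sep`. -/
theorem stmt9 (Γ : SerreGraph) :
    Nat.card (ConnectedComponents
        ↥{v : Γ.E → ℝ | Γ.IsCycle v ∧ ∀ e, e ∉ Γ.Esep → v e ≠ 0}) =
      Nat.card {O : Set Γ.E // Γ.IsTotallyCyclic Γ.Esep O} := by
  refine Nat.card_eq_of_bijective
    (Quotient.lift
      (fun c : Γ.cographicComplement =>
        (⟨SerreGraph.posEdges c.1, SerreGraph.isTotallyCyclic_posEdges c.2⟩ :
          {O : Set Γ.E // Γ.IsTotallyCyclic Γ.Esep O}))
      fun x y h => Subtype.ext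
        (SerreGraph.connectedComponents_mk_eq_iff.1 (Quotient.sound h))) ⟨?_, ?_⟩
  · rintro ⟨x⟩ ⟨y⟩ h
    exact SerreGraph.connectedComponents_mk_eq_iff.2 (congrArg Subtype.val h)
  · rintro ⟨O, hO⟩
    obtain ⟨c, hc, rfl⟩ := hO.exists_posEdges_eq
    exact ⟨((⟨c, hc⟩ : Γ.cographicComplement) :
      ConnectedComponents Γ.cographicComplement), rfl⟩
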